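/- For every fixed integer k >= 0 and every integer n >= 0, the equality b(n+1,k) = s(n+1,k) + sum over i = 0,...,n of binomial(n,i) * E(n-i) * b(i,k) holds. Equivalently, the exponential generating function A_k(x) = sum over n >= 0 of b(n,k) x^n / n! satisfies the differential equation A_k'(x) - A_k(x) * y(x) = R_k'(x) with A_k(0) = 0, where y(x) = sum over n >= 0 of E(n) x^n / n! and R_k(x) = sum over n >= 0 of s(n,k) x^n / n!. -/

import Mathlib

namespace BalancedTrees

/-- Plane binary trees with vertices labeled by natural numbers;
`nil` is the empty tree, and each child of a vertex is designated
as a left child or a right child. -/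
inductive BT where
  | nil : BT
  | node (label : ℕ) (l r : BT) : BT
deriving DecidableEq

namespace BT

/-- `balRank t = some k` if and only if the root of `t` is a balanced vertex of
rank `k`, i.e. every descending path from the root to a leaf has length `k`. -/
def balRank : BT → Option ℕ
  | .nil => none
  | .node _ .nil .nil => some 0
  | .node _ .nil (.node b rl rr) => (balRank (BT.node b rl rr)).map (· + 1)
  | .node _ (.node a ll lr) .nil => (balRank (BT.node a ll lr)).map (· + 1)
  | .node _ (.node a ll lr) (.node b rl rr) =>
      match balRank (BT.node a ll lr), balRank (BT.node b rl rr) with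
      | some i, some j => if i = j then some (i + 1) else none
      | _, _ => none

/-- The number of balanced vertices of rank `k` in the tree `t`. -/
def countBal (k : ℕ) : BT → ℕ
  | .nil => 0
  | .node v l r =>
      countBal k l + countBal k r +
        (if balRank (BT.node v l r) = some k then 1 else 0)

/-- The number of balanced vertices (of any rank) in the tree `t`. -/
def countBalAll : BT → ℕ
  | .nil => 0
  | .node v l r =>
      countBalAll l + countBalAll r +
        (if (balRank (BT.node v l r)).isSome then 1 else 0)

/-- Auxiliary, fuelled version of `treeOf`. -/
def treeOfAux : ℕ → List ℕ → BT
  | 0, _ => .nil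
  | _ + 1, [] => .nil
  | fuel + 1, l =>
      let m := l.foldr max 0
      BT.node m (treeOfAux fuel (l.takeWhile (· != m)))
                (treeOfAux fuel ((l.dropWhile (· != m)).tail))

/-- The decreasing binary tree `T(π)` of a sequence `π` of distinct labels:
the root is the maximum entry, and its left (resp. right) subtree is built
recursively from the part of the sequence to the left (resp. right) of the
maximum. This is a bijection between permutations of `{1,…,n}` and
decreasing binary trees on `{1,…,n}`. -/
def treeOf (l : List ℕ) : BT := treeOfAux l.length l

/-- Canonical form for non-plane 1-2 trees (as represented by plane trees):
an only child is stored as a left child, and of two (unordered) children the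
one with the larger label is stored on the left. Decreasing binary trees in
canonical form are in bijection with non-plane 1-2 trees. -/
def canonNP : BT → Bool
  | .nil => true
  | .node _ l r =>
      canonNP l && canonNP r &&
        (match l, r with
         | .nil, .nil => true
         | .node _ _ _, .nil => true
         | .nil, .node _ _ _ => false
         | .node a _ _, .node b _ _ => decide (b < a))

/-- Canonical form for plane 1-2 trees: an only child is stored as a left
child (an only child carries no left/right designation), while two children
remain ordered. Decreasing binary trees in canonical form are in bijection
with plane 1-2 trees. -/
def canonP : BT → Bool
  | .nil => true
  | .node _ l r =>
      canonP l && canonP r &&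
        (match l, r with
         | .nil, .node _ _ _ => false
         | _, _ => true)

end BT

open BT

/-- The list of all permutations of `{1,…,n}`, each written as a list. -/
def perms (n : ℕ) : List (List ℕ) := (List.range' 1 n).permutations

/-- `a n k`: the total number of balanced vertices of rank `k` over all
decreasing binary trees on `{1,…,n}`. -/
def a (n k : ℕ) : ℕ := ((perms n).map fun l => countBal k (treeOf l)).sum

/-- `r n k`: the number of decreasing binary trees on `{1,…,n}` whose root is
balanced of rank `k`. -/
def r (n k : ℕ) : ℕ :=
  ((perms n).filter fun l => decide (balRank (treeOf l) = some k)).length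

/-- `p n k`: the probability that the root of a uniformly random decreasing
binary tree on `{1,…,n}` is balanced of rank `k`; by convention `p 0 k = 1`. -/
def p (n k : ℕ) : ℚ := if n = 0 then 1 else (r n k : ℚ) / (Nat.factorial n : ℚ)

/-- The number of decreasing binary trees on `{1,…,n}` whose root is balanced. -/
def rootBal (n : ℕ) : ℕ :=
  ((perms n).filter fun l => (balRank (treeOf l)).isSome).length

/-- `proot n`: the probability that the root of a uniformly random decreasing
binary tree on `{1,…,n}` is balanced. -/
def proot (n : ℕ) : ℚ := (rootBal n : ℚ) / (Nat.factorial n : ℚ)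

/-- The total number of balanced vertices over all decreasing binary trees
on `{1,…,n}`. -/
def totalBal (n : ℕ) : ℕ := ((perms n).map fun l => countBalAll (treeOf l)).sum

/-- `Pbal n`: the probability that a vertex chosen uniformly at random from
the `n * n!` vertices of all decreasing binary trees on `{1,…,n}` is balanced. -/
def Pbal (n : ℕ) : ℚ := (totalBal n : ℚ) / ((n : ℚ) * (Nat.factorial n : ℚ))

/-- Permutations whose decreasing binary tree is a canonical representative
of a non-plane 1-2 tree; these are in bijection with non-plane 1-2 trees
on `{1,…,n}`. -/
def npPerms (n : ℕ) : List (List ℕ) := (perms n).filter fun l => canonNP (treeOf l)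

/-- `E n`: the number of non-plane 1-2 trees on `{1,…,n}` (the Euler number). -/
def E (n : ℕ) : ℕ := (npPerms n).length

/-- `b n k`: the total number of balanced vertices of rank `k` over all
non-plane 1-2 trees on `{1,…,n}`. -/
def b (n k : ℕ) : ℕ := ((npPerms n).map fun l => countBal k (treeOf l)).sum

/-- `s n k`: the number of non-plane 1-2 trees on `{1,…,n}` whose root is
balanced of rank `k`. -/
def s (n k : ℕ) : ℕ :=
  ((npPerms n).filter fun l => decide (balRank (treeOf l) = some k)).length

/-- Permutations whose decreasing binary tree is a canonical representative
of a plane 1-2 tree; these are in bijection with plane 1-2 trees on `{1,…,n}`. -/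
def pPerms (n : ℕ) : List (List ℕ) := (perms n).filter fun l => canonP (treeOf l)

/-- `z n`: the number of plane 1-2 trees on `{1,…,n}`. -/
def z (n : ℕ) : ℕ := (pPerms n).length

/-- `d n k`: the total number of balanced vertices of rank `k` over all
plane 1-2 trees on `{1,…,n}`. -/
def d (n k : ℕ) : ℕ := ((pPerms n).map fun l => countBal k (treeOf l)).sum

/-- `t n k`: the number of plane 1-2 trees on `{1,…,n}` whose root is
balanced of rank `k`. -/
def t (n k : ℕ) : ℕ :=
  ((pPerms n).filter fun l => decide (balRank (treeOf l) = some k)).length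

end BalancedTrees

open BalancedTrees

namespace BalancedTrees

open BT

/-! ### The tree of a list -/

theorem foldr_max_eq {l₁ l₂ : List ℕ} {m : ℕ} (h₁ : ∀ x ∈ l₁, x < m) (h₂ : ∀ x ∈ l₂, x ≤ m) :
    (l₁ ++ m :: l₂).foldr max 0 = m := by
  induction l₁ with
  | nil =>
    suffices h : l₂.foldr max 0 ≤ m by simpa using h
    clear h₁
    induction l₂ with
    | nil => simp
    | cons a l ih => simp_all
  | cons a l ih =>
    simp only [List.mem_cons, forall_eq_or_imp] at h₁
    rw [List.cons_append, List.foldr_cons, ih h₁.2]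
    exact max_eq_right h₁.1.le

theorem treeOfAux_append {l₁ l₂ : List ℕ} {m : ℕ} (h₁ : ∀ x ∈ l₁, x < m) (h₂ : ∀ x ∈ l₂, x ≤ m)
    (fuel : ℕ) :
    treeOfAux (fuel + 1) (l₁ ++ m :: l₂) =
      .node m (treeOfAux fuel l₁) (treeOfAux fuel l₂) := by
  have hp : ∀ x ∈ l₁, (x != m) = true := fun x hx => by simpa using (h₁ x hx).ne
  rw [treeOfAux]
  · simp only [foldr_max_eq h₁ h₂, List.takeWhile_append_of_pos hp,
      List.dropWhile_append_of_pos hp]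
    simp
  · simp

theorem exists_eq_append_max {l : List ℕ} (hl : l ≠ []) :
    ∃ l₁ m l₂, l = l₁ ++ m :: l₂ ∧ (∀ x ∈ l₁, x < m) ∧ ∀ x ∈ l₂, x ≤ m := by
  induction l with
  | nil => exact absurd rfl hl
  | cons a l ih =>
    rcases eq_or_ne l [] with rfl | hne
    · exact ⟨[], a, [], by simp⟩
    obtain ⟨l₁, m, l₂, rfl, h₁, h₂⟩ := ih hne
    rcases lt_or_ge a m with h | h
    · exact ⟨a :: l₁, m, l₂, by simp, by simpa [h] using h₁, h₂⟩
    · refine ⟨[], a, l₁ ++ m :: l₂, by simp, by simp, fun x hx => ?_⟩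
      simp only [List.mem_append, List.mem_cons] at hx
      rcases hx with hx | rfl | hx
      · exact (h₁ x hx).le.trans h
      · exact h
      · exact (h₂ x hx).trans h

theorem treeOfAux_nil (fuel : ℕ) : treeOfAux fuel [] = .nil := by
  cases fuel <;> rfl

theorem treeOfAux_eq_of_length_le {fuel fuel' : ℕ} {l : List ℕ} (h : l.length ≤ fuel)
    (h' : l.length ≤ fuel') : treeOfAux fuel l = treeOfAux fuel' l := by
  induction fuel generalizing fuel' l with
  | zero =>
    obtain rfl : l = [] := by simpa using h
    simp only [treeOfAux_nil]
  | succ fuel ih =>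
    rcases eq_or_ne l [] with rfl | hne
    · simp only [treeOfAux_nil]
    obtain ⟨l₁, m, l₂, rfl, h₁, h₂⟩ := exists_eq_append_max hne
    simp only [List.length_append, List.length_cons] at h h'
    obtain ⟨fuel', rfl⟩ : ∃ j, fuel' = j + 1 := ⟨fuel' - 1, by omega⟩
    rw [treeOfAux_append h₁ h₂, treeOfAux_append h₁ h₂, ih (fuel' := fuel') (by omega) (by omega),
      ih (fuel' := fuel') (by omega) (by omega)]

theorem treeOf_nil : treeOf [] = .nil := rfl

theorem treeOf_append {l₁ l₂ : List ℕ} {m : ℕ} (h₁ : ∀ x ∈ l₁, x < m) (h₂ : ∀ x ∈ l₂, x ≤ m) :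
    treeOf (l₁ ++ m :: l₂) = .node m (treeOf l₁) (treeOf l₂) := by
  have hlen : (l₁ ++ m :: l₂).length = (l₁.length + l₂.length) + 1 := by
    simp [add_assoc]
  rw [treeOf, hlen, treeOfAux_append h₁ h₂]
  simp only [treeOf]
  rw [treeOfAux_eq_of_length_le (l := l₁) (by omega) le_rfl,
    treeOfAux_eq_of_length_le (l := l₂) (by omega) le_rfl]

theorem exists_treeOf_eq_node {l : List ℕ} (hl : l ≠ []) :
    ∃ m ∈ l, (∀ x ∈ l, x ≤ m) ∧ ∃ t u, treeOf l = .node m t u := by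
  obtain ⟨l₁, m, l₂, rfl, h₁, h₂⟩ := exists_eq_append_max hl
  refine ⟨m, by simp, fun x hx => ?_, _, _, treeOf_append h₁ h₂⟩
  simp only [List.mem_append, List.mem_cons] at hx
  rcases hx with hx | rfl | hx
  · exact (h₁ x hx).le
  · exact le_rfl
  · exact h₂ x hx

/-! ### Relabeling -/

/-- Apply `f` to every label of a tree. -/
def BT.relabel (f : ℕ → ℕ) : BT → BT
  | .nil => .nil
  | .node v l r => .node (f v) (l.relabel f) (r.relabel f)

theorem BT.balRank_relabel (f : ℕ → ℕ) (t : BT) : balRank (t.relabel f) = balRank t := by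
  induction t with
  | nil => rfl
  | node v l r ihl ihr =>
    cases l <;> cases r <;> simp_all only [relabel, balRank]

theorem BT.countBal_relabel (f : ℕ → ℕ) (k : ℕ) (t : BT) :
    countBal k (t.relabel f) = countBal k t := by
  induction t with
  | nil => rfl
  | node v l r ihl ihr =>
    have h := balRank_relabel f (.node v l r)
    rw [relabel] at h
    simp only [relabel, countBal, ihl, ihr, h]

theorem BT.canonNP_relabel {f : ℕ → ℕ} (hf : StrictMono f) (t : BT) :
    canonNP (t.relabel f) = canonNP t := by
  induction t with
  | nil => rfl
  | node v l r ihl ihr =>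
    rw [relabel, canonNP.eq_def, canonNP.eq_def (.node v l r)]
    simp only [ihl, ihr]
    cases l <;> cases r <;> simp [relabel, hf.lt_iff_lt]

theorem treeOf_map {f : ℕ → ℕ} (hf : StrictMono f) (l : List ℕ) :
    treeOf (l.map f) = (treeOf l).relabel f := by
  induction hn : l.length using Nat.strong_induction_on generalizing l with
  | _ n ih =>
    rcases eq_or_ne l [] with rfl | hne
    · rfl
    obtain ⟨l₁, m, l₂, rfl, h₁, h₂⟩ := exists_eq_append_max hne
    simp only [List.length_append, List.length_cons] at hn
    have h₁' : ∀ x ∈ l₁.map f, x < f m := by simpa [hf.lt_iff_lt] using h₁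
    have h₂' : ∀ x ∈ l₂.map f, x ≤ f m := by simpa [hf.le_iff_le] using h₂
    rw [List.map_append, List.map_cons, treeOf_append h₁' h₂', treeOf_append h₁ h₂, relabel,
      ih _ (by omega) l₁ rfl, ih _ (by omega) l₂ rfl]

/-! ### Sums over non-plane 1-2 trees -/

/-- All arrangements of a finite set as a list. -/
def arrangements (S : Finset ℕ) : Finset (List ℕ) :=
  ⟨S.val.lists, Multiset.lists_nodup_finset S⟩

theorem mem_arrangements {S : Finset ℕ} {l : List ℕ} :
    l ∈ arrangements S ↔ l.Nodup ∧ l.toFinset = S := by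
  rw [arrangements, Finset.mem_mk, Multiset.mem_lists_iff, Multiset.quot_mk_to_coe]
  constructor
  · intro h
    have hnd : l.Nodup := by rw [← Multiset.coe_nodup, ← h]; exact S.nodup
    refine ⟨hnd, Finset.ext fun x => ?_⟩
    rw [List.mem_toFinset, ← Finset.mem_val, h, Multiset.mem_coe]
  · rintro ⟨hnd, rfl⟩
    rw [List.toFinset_val, hnd.dedup]

theorem mem_iff_of_mem_arrangements {S : Finset ℕ} {l : List ℕ} (h : l ∈ arrangements S) {x : ℕ} :
    x ∈ l ↔ x ∈ S := by
  rw [← (mem_arrangements.1 h).2, List.mem_toFinset]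

theorem arrangements_empty : arrangements ∅ = {[]} := by
  ext l
  rw [mem_arrangements, List.toFinset_eq_empty_iff, Finset.mem_singleton]
  exact ⟨And.right, fun h => ⟨h ▸ List.nodup_nil, h⟩⟩

/-- The sum of `w` over the non-plane 1-2 trees with label set `S`. -/
def treeSum (w : BT → ℕ) (S : Finset ℕ) : ℕ :=
  ∑ l ∈ arrangements S with canonNP (treeOf l), w (treeOf l)

theorem treeSum_image {w : BT → ℕ} {f : ℕ → ℕ} (hf : StrictMono f)
    (hw : ∀ t : BT, w (t.relabel f) = w t) (S : Finset ℕ) :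
    treeSum w (S.image f) = treeSum w S := by
  refine (Finset.sum_bij (fun l _ => l.map f) ?_ ?_ ?_ ?_).symm
  · intro l hl
    rw [Finset.mem_filter, mem_arrangements] at hl
    obtain ⟨⟨hnd, rfl⟩, hc⟩ := hl
    rw [Finset.mem_filter, mem_arrangements, treeOf_map hf, canonNP_relabel hf]
    refine ⟨⟨hnd.map hf.injective, ?_⟩, hc⟩
    ext x
    simp
  · intro l _ l' _ h
    exact hf.injective.list_map h
  · intro l hl
    rw [Finset.mem_filter, mem_arrangements] at hl
    obtain ⟨⟨hnd, hS⟩, hc⟩ := hl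
    have hmem : ∀ x ∈ l, ∃ y, f y = x := fun x hx => by
      have : x ∈ S.image f := hS ▸ List.mem_toFinset.2 hx
      obtain ⟨y, _, rfl⟩ := Finset.mem_image.1 this
      exact ⟨y, rfl⟩
    obtain ⟨l, rfl⟩ : ∃ l' : List ℕ, l'.map f = l := by
      rw [← Set.mem_range, Set.range_list_map]
      exact hmem
    refine ⟨l, ?_, rfl⟩
    rw [treeOf_map hf, canonNP_relabel hf] at hc
    rw [Finset.mem_filter, mem_arrangements]
    refine ⟨⟨List.Nodup.of_map f hnd, ?_⟩, hc⟩
    apply Finset.image_injective hf.injective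
    rw [← hS]
    ext x
    simp
  · intro l _
    rw [treeOf_map hf, hw]

theorem exists_strictMono_image_range (S : Finset ℕ) :
    ∃ f : ℕ → ℕ, StrictMono f ∧ (Finset.range S.card).image f = S := by
  refine ⟨fun i => if h : i < S.card then S.orderEmbOfFin rfl ⟨i, h⟩ else S.sup id + 1 + i,
    fun i j hij => ?_, ?_⟩
  · dsimp only
    split_ifs with hi hj hj
    · simpa using hij
    · have := Finset.le_sup (f := id) (S.orderEmbOfFin_mem rfl ⟨i, hi⟩)
      simp only [id] at this
      omega
    · omega
    · omega
  · conv_rhs => rw [← S.image_orderEmbOfFin_univ rfl]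
    ext x
    simp only [Finset.mem_image, Finset.mem_range, Finset.mem_univ, true_and]
    constructor
    · rintro ⟨i, hi, rfl⟩
      exact ⟨⟨i, hi⟩, by simp [hi]⟩
    · rintro ⟨i, rfl⟩
      exact ⟨i, i.2, by simp⟩

theorem treeSum_eq_of_card_eq {w : BT → ℕ} (hw : ∀ f (t : BT), w (t.relabel f) = w t)
    {S T : Finset ℕ} (h : S.card = T.card) : treeSum w S = treeSum w T := by
  obtain ⟨f, hf, hS⟩ := exists_strictMono_image_range S
  obtain ⟨g, hg, hT⟩ := exists_strictMono_image_range T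
  rw [← hS, ← hT, treeSum_image hf (hw f), treeSum_image hg (hw g), h]

/-! ### Splitting at the root -/

theorem sum_arrangements_insert {S : Finset ℕ} {m : ℕ} (hm : m ∉ S) (g : List ℕ → ℕ) :
    ∑ l ∈ arrangements (insert m S), g l =
      ∑ A ∈ S.powerset, ∑ p ∈ arrangements A ×ˢ arrangements (S \ A), g (p.1 ++ m :: p.2) := by
  rw [Finset.sum_sigma']
  refine (Finset.sum_bij (fun q _ => q.2.1 ++ m :: q.2.2) ?_ ?_ ?_ ?_).symm
  · rintro ⟨A, l₁, l₂⟩ h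
    simp only [Finset.mem_sigma, Finset.mem_powerset, Finset.mem_product, mem_arrangements] at h
    obtain ⟨hA, ⟨h₁, rfl⟩, h₂, hS⟩ := h
    have key : ∀ x, x ∈ l₂ ↔ x ∈ S ∧ x ∉ l₁ := fun x => by
      rw [← List.mem_toFinset, hS]
      simp
    have hA' : ∀ x ∈ l₁, x ∈ S := fun x hx => hA (List.mem_toFinset.2 hx)
    rw [mem_arrangements]
    constructor
    · rw [List.nodup_append, List.nodup_cons]
      grind
    · ext x
      simp only [List.mem_toFinset, List.mem_append, List.mem_cons, Finset.mem_insert]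
      grind
  · rintro ⟨A, l₁, l₂⟩ h ⟨A', l₁', l₂'⟩ h' heq
    simp only [Finset.mem_sigma, Finset.mem_powerset, Finset.mem_product, mem_arrangements] at h h'
    obtain ⟨hA, ⟨h₁, rfl⟩, h₂, hS⟩ := h
    obtain ⟨hA', ⟨h₁', rfl⟩, h₂', hS'⟩ := h'
    have n₂ : m ∉ l₂ := fun h => by
      rw [← List.mem_toFinset, hS, Finset.mem_sdiff] at h
      exact hm h.1
    have n₁ : m ∉ l₁ := fun h => hm (hA (List.mem_toFinset.2 h))
    have := (List.append_cons_inj_of_notMem n₁ n₂).1 heq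
    obtain ⟨rfl, -, rfl⟩ := this
    rfl
  · intro l hl
    rw [mem_arrangements] at hl
    obtain ⟨hnd, hS⟩ := hl
    have hml : m ∈ l := by
      rw [← List.mem_toFinset, hS]
      simp
    obtain ⟨l₁, l₂, rfl⟩ := List.append_of_mem hml
    have key : ∀ x, (x ∈ l₁ ∨ x = m ∨ x ∈ l₂) ↔ (x = m ∨ x ∈ S) := fun x => by
      have := Finset.ext_iff.1 hS x
      simpa [or_left_comm] using this
    rw [List.nodup_append, List.nodup_cons] at hnd
    refine ⟨⟨l₁.toFinset, l₁, l₂⟩, ?_, rfl⟩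
    simp only [Finset.mem_sigma, Finset.mem_powerset, Finset.mem_product, mem_arrangements]
    refine ⟨fun x hx => ?_, ⟨hnd.1, trivial⟩, hnd.2.1.2, ?_⟩
    · rw [List.mem_toFinset] at hx
      grind
    · ext x
      simp only [Finset.mem_sdiff, List.mem_toFinset]
      grind
  · intros
    rfl

/-- For a label set with maximum `M`, split in two arrangements, the condition on the children
of a canonical tree says that the left child carries the label `M`. -/
theorem canonNP_node_treeOf {S A : Finset ℕ} {M m : ℕ} (hM : M ∈ S) (hmax : ∀ x ∈ S, x ≤ M)
    (hA : A ⊆ S) {l₁ l₂ : List ℕ} (h₁ : l₁ ∈ arrangements A) (h₂ : l₂ ∈ arrangements (S \ A)) :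
    canonNP (.node m (treeOf l₁) (treeOf l₂)) = true ↔
      M ∈ A ∧ canonNP (treeOf l₁) = true ∧ canonNP (treeOf l₂) = true := by
  have m₁ : ∀ x, x ∈ l₁ ↔ x ∈ A := fun x => mem_iff_of_mem_arrangements h₁
  have m₂ : ∀ x, x ∈ l₂ ↔ x ∈ S ∧ x ∉ A := fun x => by
    rw [mem_iff_of_mem_arrangements h₂, Finset.mem_sdiff]
  rw [canonNP.eq_def]
  by_cases hMA : M ∈ A
  · obtain ⟨v, hv, hvmax, t, u, ht⟩ := exists_treeOf_eq_node (List.ne_nil_of_mem ((m₁ M).2 hMA))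
    obtain rfl : v = M := le_antisymm (hmax v (hA ((m₁ v).1 hv))) (hvmax M ((m₁ M).2 hMA))
    rcases eq_or_ne l₂ [] with rfl | hne
    · simp [ht, treeOf_nil, hMA]
    · obtain ⟨c, hc, -, t', u', ht'⟩ := exists_treeOf_eq_node hne
      have hcv : c < v := lt_of_le_of_ne (hmax c ((m₂ c).1 hc).1) fun h =>
        ((m₂ c).1 hc).2 (h ▸ hMA)
      simp [ht, ht', hMA, hcv]
  · have hMl : M ∈ l₂ := (m₂ M).2 ⟨hM, hMA⟩
    obtain ⟨v, hv, hvmax, t, u, ht⟩ := exists_treeOf_eq_node (List.ne_nil_of_mem hMl)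
    obtain rfl : v = M := le_antisymm (hmax v ((m₂ v).1 hv).1) (hvmax M hMl)
    rcases eq_or_ne l₁ [] with rfl | hne
    · simp [ht, treeOf_nil, hMA]
    · obtain ⟨c, hc, -, t', u', ht'⟩ := exists_treeOf_eq_node hne
      have hcv : ¬ v < c := (hmax c (hA ((m₁ c).1 hc))).not_gt
      simp [ht, ht', hMA, hcv]

/-- The number of balanced vertices of rank `k` that are not the root. -/
def BT.countBalBelow (k : ℕ) : BT → ℕ
  | .nil => 0
  | .node _ l r => countBal k l + countBal k r

theorem treeSum_countBal (k : ℕ) {S : Finset ℕ} (hS : S.Nonempty) :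
    treeSum (countBal k) S =
      treeSum (fun t => if balRank t = some k then 1 else 0) S + treeSum (countBalBelow k) S := by
  rw [treeSum, treeSum, treeSum, ← Finset.sum_add_distrib]
  refine Finset.sum_congr rfl fun l hl => ?_
  obtain ⟨x, hx⟩ := hS
  have hx := (mem_iff_of_mem_arrangements (Finset.mem_filter.1 hl).1).2 hx
  obtain ⟨m, -, -, t, u, ht⟩ := exists_treeOf_eq_node (List.ne_nil_of_mem hx)
  rw [ht, countBal, countBalBelow, add_comm]

theorem treeSum_countBalBelow_insert (k : ℕ) {S : Finset ℕ} {m : ℕ} (hm : ∀ x ∈ S, x < m) :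
    treeSum (countBalBelow k) (insert m S) =
      ∑ A ∈ S.powerset, treeSum (countBal k) A * treeSum (fun _ => 1) (S \ A) := by
  have hmS : m ∉ S := fun h => (hm m h).false
  rw [treeSum, Finset.sum_filter, sum_arrangements_insert hmS]
  have hsplit : ∀ A ∈ S.powerset, ∀ p ∈ arrangements A ×ˢ arrangements (S \ A),
      treeOf (p.1 ++ m :: p.2) = .node m (treeOf p.1) (treeOf p.2) := by
    intro A hA p hp
    rw [Finset.mem_product] at hp
    refine treeOf_append (fun x hx => hm x ?_) fun x hx => (hm x ?_).le
    · exact Finset.mem_powerset.1 hA ((mem_iff_of_mem_arrangements hp.1).1 hx)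
    · exact Finset.sdiff_subset ((mem_iff_of_mem_arrangements hp.2).1 hx)
  rcases S.eq_empty_or_nonempty with rfl | hne
  · have h : treeOf [m] = .node m .nil .nil := treeOf_append (l₁ := []) (by simp) (by simp)
    simp [arrangements_empty, treeSum, treeOf_nil, h, countBalBelow, countBal]
  set M := S.max' hne
  have hM : M ∈ S := S.max'_mem hne
  have hmax : ∀ x ∈ S, x ≤ M := fun x hx => S.le_max' x hx
  have hinner : ∀ A ∈ S.powerset, (∑ p ∈ arrangements A ×ˢ arrangements (S \ A),
      if canonNP (treeOf (p.1 ++ m :: p.2)) = true then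
        countBalBelow k (treeOf (p.1 ++ m :: p.2)) else 0) =
      if M ∈ A then treeSum (countBal k) A * treeSum (fun _ => 1) (S \ A) +
        treeSum (fun _ => 1) A * treeSum (countBal k) (S \ A) else 0 := by
    intro A hA
    have hterm : ∀ p ∈ arrangements A ×ˢ arrangements (S \ A),
        (if canonNP (treeOf (p.1 ++ m :: p.2)) = true then
          countBalBelow k (treeOf (p.1 ++ m :: p.2)) else 0) =
        if M ∈ A ∧ canonNP (treeOf p.1) = true ∧ canonNP (treeOf p.2) = true then
          countBal k (treeOf p.1) + countBal k (treeOf p.2) else 0 := by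
      intro p hp
      rw [hsplit A hA p hp, countBalBelow]
      rw [Finset.mem_product] at hp
      simp only [canonNP_node_treeOf hM hmax (Finset.mem_powerset.1 hA) hp.1 hp.2]
    rw [Finset.sum_congr rfl hterm]
    split_ifs with hMA
    · simp only [hMA, true_and]
      rw [← Finset.sum_filter, Finset.filter_product (fun l => canonNP (treeOf l) = true)
        (fun l => canonNP (treeOf l) = true), Finset.sum_add_distrib]
      simp only [treeSum, Finset.sum_mul_sum, ← Finset.sum_product', mul_one, one_mul]
    · simp [hMA]
  rw [Finset.sum_congr rfl hinner, ← Finset.sum_filter, Finset.sum_add_distrib,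
    ← Finset.sum_filter_add_sum_filter_not S.powerset (fun A => M ∈ A)]
  congr 1
  refine Finset.sum_bij' (fun A _ => S \ A) (fun A _ => S \ A) ?_ ?_ ?_ ?_ ?_
  · intro A hA
    simp_all
  · intro A hA
    simp_all
  · intro A hA
    simp_all
  · intro A hA
    simp_all
  · intro A hA
    simp_all [mul_comm]

/-! ### The recurrence -/

theorem npPerms_map_sum (n : ℕ) (w : BT → ℕ) :
    ((npPerms n).map fun l => w (treeOf l)).sum = treeSum w (Finset.Icc 1 n) := by
  have hnd : (npPerms n).Nodup :=
    (List.nodup_permutations _ List.nodup_range').filter _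
  rw [← List.sum_toFinset (fun l => w (treeOf l)) hnd, treeSum]
  congr 1
  ext l
  rw [List.mem_toFinset, npPerms, List.mem_filter, Finset.mem_filter, mem_arrangements, perms,
    List.mem_permutations]
  refine and_congr_left fun _ => ⟨fun h => ?_, fun ⟨h, h'⟩ => ?_⟩
  · refine ⟨h.nodup_iff.2 List.nodup_range', ?_⟩
    ext x
    rw [List.mem_toFinset, h.mem_iff, List.mem_range'_1, Finset.mem_Icc]
    omega
  · refine (List.perm_ext_iff_of_nodup h List.nodup_range').2 fun x => ?_
    rw [← List.mem_toFinset, h', List.mem_range'_1, Finset.mem_Icc]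
    omega

theorem E_eq_treeSum (S : Finset ℕ) : E S.card = treeSum (fun _ => 1) S := by
  have h := npPerms_map_sum S.card fun _ => 1
  rw [List.map_const', List.sum_replicate, smul_eq_mul, mul_one] at h
  rw [E, h]
  exact treeSum_eq_of_card_eq (fun _ _ => rfl) (by simp)

theorem b_eq_treeSum (k : ℕ) (S : Finset ℕ) : b S.card k = treeSum (countBal k) S := by
  rw [b, npPerms_map_sum]
  exact treeSum_eq_of_card_eq (fun f t => countBal_relabel f k t) (by simp)

theorem s_eq_treeSum (n k : ℕ) :
    s n k = treeSum (fun t => if balRank t = some k then 1 else 0) (Finset.Icc 1 n) := by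
  rw [← npPerms_map_sum, s, ← List.countP_eq_length_filter]
  induction npPerms n with
  | nil => rfl
  | cons l L ih =>
    rw [List.countP_cons, List.map_cons, List.sum_cons, ih, add_comm]
    simp

end BalancedTrees

/-- For every fixed `k ≥ 0` and every `n ≥ 0`,
`b(n+1,k) = s(n+1,k) + ∑_{i=0}^{n} C(n,i) * E(n-i) * b(i,k)`,
which is the coefficientwise form of the differential equation
`A_k'(x) - A_k(x) y(x) = R_k'(x)` with `A_k(0) = 0`, where `y` is the
exponential generating function of the Euler numbers `E(n)`. -/
theorem statement8 (k n : ℕ) :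
    b (n + 1) k =
      s (n + 1) k +
        ∑ i ∈ Finset.range (n + 1), n.choose i * E (n - i) * b i k := by
  have hIcc : Finset.Icc 1 (n + 1) = insert (n + 1) (Finset.Icc 1 n) := by
    ext x
    simp only [Finset.mem_Icc, Finset.mem_insert]
    omega
  have hb := b_eq_treeSum k (Finset.Icc 1 (n + 1))
  rw [Nat.card_Icc, Nat.add_sub_cancel] at hb
  rw [hb, treeSum_countBal k (by simp), ← s_eq_treeSum, hIcc,
    treeSum_countBalBelow_insert k fun x hx => by
      rw [Finset.mem_Icc] at hx
      omega]
  congr 1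
  have hsum := Finset.sum_powerset_apply_card (fun i => b i k * E (n - i)) (x := Finset.Icc 1 n)
  rw [Nat.card_Icc, Nat.add_sub_cancel] at hsum
  trans ∑ A ∈ (Finset.Icc 1 n).powerset, b A.card k * E (n - A.card)
  · refine Finset.sum_congr rfl fun A hA => ?_
    rw [← b_eq_treeSum, ← E_eq_treeSum, Finset.card_sdiff_of_subset (Finset.mem_powerset.1 hA),
      Nat.card_Icc, Nat.add_sub_cancel]
  · rw [hsum]
    refine Finset.sum_congr rfl fun i _ => ?_
    rw [smul_eq_mul]
    ring
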